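/- arXiv:1601.05297 — 2 statements merged into one kernel-verified Lean document; each statement's English description precedes it below -/
import Mathlib

section
/- (Compactness of energy sublevel sets.) Let T > 0 and c ≥ 0. The set of continuous functions λ : [0,T] → ℝ such that λ(0) = 0 and there exists a measurable h : ℝ → ℝ, square-integrable on (0,T), with λ(t) = ∫₀^t h(s) ds for all t ∈ [0,T] and (1/2)∫₀^T h(s)² ds ≤ c, is a compact subset of the space C([0,T], ℝ) of continuous real-valued functions on [0,T] equipped with the supremum metric. -/
open MeasureTheory Filter Set

/-- The weak-* pairing is jointly continuous on norm balls of the dual. -/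
theorem WeakDual.continuous_eval_closedBall {E : Type*} [NormedAddCommGroup E] [NormedSpace ℝ E]
    {R : ℝ} (hR : 0 ≤ R) :
    Continuous fun p : (WeakDual.toStrongDual (𝕜 := ℝ) (E := E) ⁻¹' Metric.closedBall 0 R) × E =>
      (p.1 : WeakDual ℝ E) p.2 := by
  refine continuous_prod_of_continuous_lipschitzWith' _ ⟨R, hR⟩ (fun φ => ?_) fun x => ?_
  · refine LipschitzWith.of_dist_le_mul fun x y => ?_
    have h : ‖WeakDual.toStrongDual (φ : WeakDual ℝ E)‖ ≤ R :=
      mem_closedBall_zero_iff.mp φ.2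
    have := (WeakDual.toStrongDual (φ : WeakDual ℝ E)).le_of_opNorm_le h (x - y)
    rw [map_sub] at this
    rw [dist_eq_norm, dist_eq_norm]
    exact this
  · exact (WeakDual.eval_continuous x).comp continuous_subtype_val

/-- Indicator functions of the intervals `(0, t]` depend continuously on `t` in `L²(0, T)`. -/
theorem continuous_indicatorConstLp_Ioc (μ : Measure ℝ) [IsFiniteMeasure μ] (hμ : μ ≤ volume) :
    Continuous fun t : ℝ =>
      indicatorConstLp (μ := μ) 2 (measurableSet_Ioc (a := 0) (b := t)) (measure_ne_top _ _)
        (1 : ℝ) := by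
  refine continuous_indicatorConstLp_set (by simp) fun t => ?_
  have h0 : Tendsto (fun s : ℝ => ENNReal.ofReal |s - t|) (nhds t) (nhds 0) := by
    have : Continuous fun s : ℝ => ENNReal.ofReal |s - t| :=
      ENNReal.continuous_ofReal.comp (by fun_prop)
    simpa using this.tendsto t
  refine tendsto_of_tendsto_of_tendsto_of_le_of_le tendsto_const_nhds h0 (fun _ => zero_le)
    fun s => ?_
  calc μ (symmDiff (Ioc 0 s) (Ioc 0 t)) ≤ volume (uIoc t s) := by
        refine (hμ _).trans (measure_mono fun x hx => ?_)
        simp only [mem_symmDiff, mem_Ioc, mem_uIoc] at *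
        grind
    _ = ENNReal.ofReal |s - t| := Real.volume_uIoc

/-- Pairing with an indicator in `L²(0, T)` is an interval integral. -/
theorem inner_indicatorConstLp_Ioc {T t : ℝ} (ht : t ∈ Icc 0 T)
    (f : Lp ℝ 2 (volume.restrict (Ioc 0 T))) :
    inner ℝ f (indicatorConstLp (μ := volume.restrict (Ioc 0 T)) 2
      (measurableSet_Ioc (a := 0) (b := t)) (measure_ne_top _ _) (1 : ℝ)) =
      ∫ s in (0 : ℝ)..t, f s := by
  rw [real_inner_comm, L2.inner_indicatorConstLp_one, intervalIntegral.integral_of_le ht.1,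
    Measure.restrict_restrict measurableSet_Ioc,
    inter_eq_left.mpr (Ioc_subset_Ioc_right ht.2)]

/-- The squared norm in `L²(0, T)` is an interval integral. -/
theorem norm_sq_eq_intervalIntegral {T : ℝ} (hT : 0 ≤ T)
    (f : Lp ℝ 2 (volume.restrict (Ioc 0 T))) :
    ‖f‖ ^ 2 = ∫ s in (0 : ℝ)..T, f s ^ 2 := by
  rw [← real_inner_self_eq_norm_sq, L2.inner_def, intervalIntegral.integral_of_le hT]
  simp

/-- Compactness of the sublevel sets of the Dirichlet energy in `C([0,T], ℝ)`:
the set of continuous `λ : [0,T] → ℝ` with `λ(0) = 0` that are absolutely continuous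
with square-integrable derivative `h` of energy `(1/2)∫₀^T h² ≤ c` is compact for
the supremum metric. -/
theorem energy_sublevel_isCompact (T : ℝ) (hT : 0 < T) (c : ℝ) (hc : 0 ≤ c) :
    IsCompact {f : C(Set.Icc (0:ℝ) T, ℝ) |
      f ⟨0, Set.left_mem_Icc.mpr hT.le⟩ = 0 ∧
      ∃ h : ℝ → ℝ, Measurable h ∧
        IntegrableOn (fun s => h s ^ 2) (Set.Ioc 0 T) ∧
        (∀ t : Set.Icc (0:ℝ) T, f t = ∫ s in (0:ℝ)..(t : ℝ), h s) ∧
        (1/2 : ℝ) * ∫ s in (0:ℝ)..T, (h s) ^ 2 ≤ c} := by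
  set μ := volume.restrict (Ioc (0 : ℝ) T)
  set R := √(2 * c)
  have hR : 0 ≤ R := Real.sqrt_nonneg _
  have hR2 : R ^ 2 = 2 * c := Real.sq_sqrt (by positivity)
  set K := WeakDual.toStrongDual (𝕜 := ℝ) (E := Lp ℝ 2 μ) ⁻¹' Metric.closedBall 0 R
  have : CompactSpace K := isCompact_iff_compactSpace.mp (WeakDual.isCompact_closedBall 0 R)
  let F : C(K × Icc (0 : ℝ) T, ℝ) :=
    ⟨fun p => (p.1 : WeakDual ℝ (Lp ℝ 2 μ)) (indicatorConstLp (μ := μ) 2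
        (measurableSet_Ioc (a := 0) (b := (p.2 : ℝ))) (measure_ne_top _ _) (1 : ℝ)),
      (WeakDual.continuous_eval_closedBall hR).comp
        (continuous_fst.prodMk ((continuous_indicatorConstLp_Ioc μ Measure.restrict_le_self).comp
          (continuous_subtype_val.comp continuous_snd)))⟩
  convert isCompact_range F.curry.continuous using 1
  ext f
  constructor
  · rintro ⟨-, h, hm, hi, hf, hE⟩
    have hL : MemLp h 2 μ := (memLp_two_iff_integrable_sq hm.aestronglyMeasurable).mpr hi
    have hae : hL.toLp h =ᵐ[μ] h := hL.coeFn_toLp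
    have hn : ‖hL.toLp h‖ ≤ R := by
      refine le_of_sq_le_sq ?_ hR
      rw [norm_sq_eq_intervalIntegral hT.le, hR2]
      have : ∫ s in (0 : ℝ)..T, hL.toLp h s ^ 2 = ∫ s in (0 : ℝ)..T, h s ^ 2 := by
        rw [intervalIntegral.integral_of_le hT.le, intervalIntegral.integral_of_le hT.le]
        exact integral_congr_ae (hae.mono fun s hs => by simp only [hs])
      linarith
    refine ⟨⟨StrongDual.toWeakDual (InnerProductSpace.toDual ℝ _ (hL.toLp h)), ?_⟩, ?_⟩
    · simpa [K] using hn
    · ext t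
      rw [hf t]
      refine (inner_indicatorConstLp_Ioc t.2 (hL.toLp h)).trans ?_
      rw [intervalIntegral.integral_of_le t.2.1, intervalIntegral.integral_of_le t.2.1]
      exact integral_congr_ae
        (ae_restrict_of_ae_restrict_of_subset (Ioc_subset_Ioc_right t.2.2) hae)
  · rintro ⟨φ, rfl⟩
    set g := (InnerProductSpace.toDual ℝ (Lp ℝ 2 μ)).symm
      (WeakDual.toStrongDual (φ : WeakDual ℝ (Lp ℝ 2 μ))) with hg
    have hn : ‖g‖ ≤ R := by
      rw [hg, LinearIsometryEquiv.norm_map]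
      exact mem_closedBall_zero_iff.mp φ.2
    have hF (t : Icc (0 : ℝ) T) : F.curry φ t = ∫ s in (0 : ℝ)..t, g s := by
      rw [← inner_indicatorConstLp_Ioc t.2 g]
      exact InnerProductSpace.toDual_symm_apply.symm
    refine ⟨by simp [hF], g, (Lp.stronglyMeasurable g).measurable,
      (memLp_two_iff_integrable_sq (Lp.aestronglyMeasurable g)).mp (Lp.memLp g), hF, ?_⟩
    rw [← norm_sq_eq_intervalIntegral hT.le]
    have := pow_le_pow_left₀ (norm_nonneg g) hn 2
    linarith
end

section
/- For 0 < κ < 8 and w ≥ 0, define h_κ(w) = (1/2)·(∫_w^∞ (s²+1)^{−4/κ} ds) / (∫₀^∞ (s²+1)^{−4/κ} ds). Then for every fixed w ≥ 0, κ·ln h_κ(w) converges to −4 ln(w² + 1) as κ → 0⁺. -/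
open MeasureTheory Filter Set

lemma integrable_sq_add_one_rpow_neg {p : ℝ} (hp : 1 ≤ p) :
    Integrable (fun s : ℝ => (s ^ 2 + 1) ^ (-p)) := by
  have h := integrable_rpow_neg_one_add_norm_sq (E := ℝ) (μ := volume) (r := 2 * p)
    (by rw [Module.finrank_self]; push_cast; linarith)
  refine h.congr (Eventually.of_forall fun s => ?_)
  simp only [Real.norm_eq_abs, sq_abs]
  rw [add_comm]
  congr 1
  ring

lemma integral_Ioi_sq_add_one_rpow_neg_le {w p : ℝ} (hw : 0 ≤ w) (hp : 1 ≤ p) :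
    ∫ s in Ioi w, (s ^ 2 + 1) ^ (-p) ≤ (w ^ 2 + 1) ^ (1 - p) * Real.pi := by
  calc ∫ s in Ioi w, (s ^ 2 + 1) ^ (-p)
      ≤ ∫ s in Ioi w, (w ^ 2 + 1) ^ (1 - p) * (1 + s ^ 2)⁻¹ := by
        refine setIntegral_mono_on (integrable_sq_add_one_rpow_neg hp).integrableOn
          (integrable_inv_one_add_sq.const_mul _).integrableOn measurableSet_Ioi fun s hs => ?_
        have hs' : w < s := hs
        have hpos : 0 < s ^ 2 + 1 := by positivity
        rw [show -p = (1 - p) + (-1) by ring, Real.rpow_add hpos, Real.rpow_neg_one,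
          add_comm 1 (s ^ 2)]
        refine mul_le_mul_of_nonneg_right ?_ (by positivity)
        exact Real.rpow_le_rpow_of_nonpos (by positivity) (by gcongr) (by linarith)
    _ = (w ^ 2 + 1) ^ (1 - p) * ∫ s in Ioi w, (1 + s ^ 2)⁻¹ := integral_const_mul _ _
    _ ≤ (w ^ 2 + 1) ^ (1 - p) * Real.pi := by
        refine mul_le_mul_of_nonneg_left ?_ (by positivity)
        rw [← integral_univ_inv_one_add_sq]
        exact setIntegral_le_integral integrable_inv_one_add_sq
          (Eventually.of_forall fun s => by positivity)

lemma le_integral_Ioi_sq_add_one_rpow_neg {w p d : ℝ} (hw : 0 ≤ w) (hp : 1 ≤ p) (hd : 0 < d) :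
    d * ((w + d) ^ 2 + 1) ^ (-p) ≤ ∫ s in Ioi w, (s ^ 2 + 1) ^ (-p) := by
  have hint := integrable_sq_add_one_rpow_neg hp
  calc d * ((w + d) ^ 2 + 1) ^ (-p)
      = ∫ _ in Ioc w (w + d), ((w + d) ^ 2 + 1) ^ (-p) := by
        simp [hd.le]
    _ ≤ ∫ s in Ioc w (w + d), (s ^ 2 + 1) ^ (-p) := by
        refine setIntegral_mono_on (by simp) hint.integrableOn measurableSet_Ioc fun s hs => ?_
        have h0 : 0 ≤ s := hw.trans hs.1.le
        have h1 : s ≤ w + d := hs.2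
        exact Real.rpow_le_rpow_of_nonpos (by positivity) (by gcongr) (by linarith)
    _ ≤ ∫ s in Ioi w, (s ^ 2 + 1) ^ (-p) :=
        setIntegral_mono_set hint.integrableOn
          (Eventually.of_forall fun s => by positivity) Ioc_subset_Ioi_self.eventuallyLE

lemma integral_Ioi_sq_add_one_rpow_neg_pos {w p : ℝ} (hw : 0 ≤ w) (hp : 1 ≤ p) :
    0 < ∫ s in Ioi w, (s ^ 2 + 1) ^ (-p) :=
  lt_of_lt_of_le (by positivity) (le_integral_Ioi_sq_add_one_rpow_neg hw hp one_pos)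

lemma eventually_one_le_four_div :
    ∀ᶠ κ : ℝ in nhdsWithin 0 (Ioi 0), 0 < κ ∧ 1 ≤ 4 / κ := by
  filter_upwards [Ioo_mem_nhdsGT (show (0 : ℝ) < 4 by norm_num)] with κ hκ
  exact ⟨hκ.1, (one_le_div hκ.1).2 hκ.2.le⟩

lemma tendsto_mul_log_integral_Ioi (w : ℝ) (hw : 0 ≤ w) :
    Tendsto (fun κ : ℝ => κ * Real.log (∫ s in Ioi w, (s ^ 2 + 1) ^ (-(4 / κ))))
      (nhdsWithin 0 (Ioi 0)) (nhds (-4 * Real.log (w ^ 2 + 1))) := by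
  have hlow : Tendsto (fun κ : ℝ => κ * Real.log κ + -4 * Real.log ((w + κ) ^ 2 + 1))
      (nhdsWithin 0 (Ioi 0)) (nhds (-4 * Real.log (w ^ 2 + 1))) := by
    have hc : Continuous fun κ : ℝ => κ * Real.log κ + -4 * Real.log ((w + κ) ^ 2 + 1) :=
      Real.continuous_mul_log.add
        (continuous_const.mul (Continuous.log (by fun_prop) fun κ => by positivity))
    simpa using (hc.tendsto 0).mono_left nhdsWithin_le_nhds
  have hup : Tendsto (fun κ : ℝ => (κ - 4) * Real.log (w ^ 2 + 1) + κ * Real.log Real.pi)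
      (nhdsWithin 0 (Ioi 0)) (nhds (-4 * Real.log (w ^ 2 + 1))) := by
    have hc : Continuous fun κ : ℝ =>
        (κ - 4) * Real.log (w ^ 2 + 1) + κ * Real.log Real.pi := by fun_prop
    simpa using (hc.tendsto 0).mono_left nhdsWithin_le_nhds
  refine tendsto_of_tendsto_of_tendsto_of_le_of_le' hlow hup ?_ ?_
  · filter_upwards [eventually_one_le_four_div] with κ ⟨hκ, hp⟩
    have h := Real.log_le_log (by positivity) (le_integral_Ioi_sq_add_one_rpow_neg hw hp hκ)
    rw [Real.log_mul hκ.ne' (by positivity), Real.log_rpow (by positivity)] at h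
    refine le_trans (le_of_eq ?_) (mul_le_mul_of_nonneg_left h hκ.le)
    field_simp
  · filter_upwards [eventually_one_le_four_div] with κ ⟨hκ, hp⟩
    have h := Real.log_le_log (integral_Ioi_sq_add_one_rpow_neg_pos hw hp)
      (integral_Ioi_sq_add_one_rpow_neg_le hw hp)
    rw [Real.log_mul (by positivity) Real.pi_ne_zero, Real.log_rpow (by positivity)] at h
    refine (mul_le_mul_of_nonneg_left h hκ.le).trans (le_of_eq ?_)
    field_simp

/-- For Schramm's left-passage probability
`h_κ(w) = (1/2)·(∫_w^∞ (s²+1)^{−4/κ} ds)/(∫₀^∞ (s²+1)^{−4/κ} ds)` one has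
`κ·ln h_κ(w) → −4 ln(w²+1)` as `κ → 0⁺`. -/
theorem kappa_log_schramm_tendsto (w : ℝ) (hw : 0 ≤ w) :
    Filter.Tendsto
      (fun κ : ℝ => κ * Real.log ((1/2 : ℝ) *
        (∫ s in Set.Ioi w, (s ^ 2 + 1) ^ (-(4 / κ))) /
        ∫ s in Set.Ioi (0:ℝ), (s ^ 2 + 1) ^ (-(4 / κ))))
      (nhdsWithin 0 (Set.Ioi 0))
      (nhds (-4 * Real.log (w ^ 2 + 1))) := by
  have hhalf : Tendsto (fun κ : ℝ => κ * Real.log (1 / 2)) (nhdsWithin 0 (Ioi 0)) (nhds 0) := by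
    have hc : Continuous fun κ : ℝ => κ * Real.log (1 / 2) := by fun_prop
    simpa using (hc.tendsto 0).mono_left nhdsWithin_le_nhds
  have h := (hhalf.add (tendsto_mul_log_integral_Ioi w hw)).sub
    (tendsto_mul_log_integral_Ioi 0 le_rfl)
  have hlim : 0 + -4 * Real.log (w ^ 2 + 1) - -4 * Real.log ((0 : ℝ) ^ 2 + 1)
      = -4 * Real.log (w ^ 2 + 1) := by simp
  rw [hlim] at h
  refine h.congr' ?_
  filter_upwards [eventually_one_le_four_div] with κ ⟨_, hp⟩
  have hIw := integral_Ioi_sq_add_one_rpow_neg_pos hw hp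
  have hI0 := integral_Ioi_sq_add_one_rpow_neg_pos le_rfl hp
  rw [Real.log_div (by positivity) hI0.ne', Real.log_mul (by norm_num) hIw.ne']
  ring
end
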